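/- Let y be a nonnegative integer and suppose p = 4y^2 + 5y + 2 is a prime with p ≥ 5. Then there does not exist a nontrivial regular (8p^3, 4p^2−2p−4y−3, 2p−8y−8, 2p−2)-partial difference set in any Abelian group of order 8p^3. -/

import Mathlib

variable {G : Type*} [CommGroup G] [DecidableEq G] [Fintype G]

/-- The number of representations of `g` as `d₁ * d₂⁻¹` with `d₁, d₂ ∈ D`, `d₁ ≠ d₂`. -/
def pdsReps (D : Finset G) (g : G) : ℕ :=
  ((D ×ˢ D).filter (fun x => x.1 ≠ x.2 ∧ x.1 * x.2⁻¹ = g)).card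

/-- `D` is a `(v,k,λ,μ)`-partial difference set in `G`. -/
def IsPDS (D : Finset G) (v k l m : ℕ) : Prop :=
  Fintype.card G = v ∧ D.card = k ∧
  (∀ g : G, g ≠ 1 → g ∈ D → pdsReps D g = l) ∧
  (∀ g : G, g ≠ 1 → g ∉ D → pdsReps D g = m)

/-- `D` is regular: closed under inverses and not containing the identity. -/
def IsRegularPDS (D : Finset G) : Prop :=
  (∀ d ∈ D, d⁻¹ ∈ D) ∧ (1 : G) ∉ D

/-- A regular PDS is trivial if `D ∪ {e}` or `G \ D` is a subgroup. -/
def IsTrivialPDS (D : Finset G) : Prop :=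
  (∃ H : Subgroup G, (H : Set G) = ↑D ∪ {1}) ∨
  (∃ H : Subgroup G, (H : Set G) = (↑D : Set G)ᶜ)

theorem Equiv.Perm.dvd_card_of_forall_pow_apply_eq {α : Type*} [Fintype α] [DecidableEq α]
    (σ : Equiv.Perm α) (n : ℕ) (h : ∀ x j, (σ ^ j) x = x → n ∣ j) : n ∣ Fintype.card α := by
  by_cases hn : n = 1
  · simp [hn]
  have hsupp : σ.support = Finset.univ := by
    ext x
    simp only [Equiv.Perm.mem_support, Finset.mem_univ, iff_true]
    intro hx
    exact hn (Nat.dvd_one.1 (h x 1 (by simpa using hx)))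
  rw [← Finset.card_univ, ← hsupp, ← Equiv.Perm.sum_cycleType]
  refine Multiset.dvd_sum fun m hm => ?_
  obtain ⟨c, τ, rfl, hd, hc, rfl⟩ := Equiv.Perm.mem_cycleType_iff.1 hm
  obtain ⟨x, hx, -⟩ := id hc
  refine h x _ ?_
  have hτ : τ x = x := (hd x).resolve_left hx
  rw [hd.commute.mul_pow, Equiv.Perm.mul_apply, Equiv.Perm.pow_apply_eq_self_of_apply_eq_self hτ,
    ← hc.orderOf, pow_orderOf_eq_one, Equiv.Perm.one_apply]

theorem dvd_card_of_forall_pow_pow_eq (S : Finset G) (s n : ℕ) (hs : (Nat.card G).Coprime s)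
    (hS : ∀ x ∈ S, x ^ s ∈ S) (h : ∀ x ∈ S, ∀ j, x ^ s ^ j = x → n ∣ j) : n ∣ S.card := by
  let f : S → S := fun x => ⟨x.1 ^ s, hS x.1 x.2⟩
  have hf : Function.Injective f := fun x y hxy =>
    Subtype.ext ((powCoprime hs).injective (congrArg Subtype.val hxy))
  let σ : Equiv.Perm S := Equiv.ofBijective f (Finite.injective_iff_bijective.1 hf)
  have hσ : ∀ (j : ℕ) (x : S), ((σ ^ j) x).1 = x.1 ^ s ^ j := by
    intro j
    induction j with
    | zero => simp
    | succ j ih =>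
      intro x
      rw [pow_succ, Equiv.Perm.mul_apply, ih, pow_succ', pow_mul]
      rfl
  rw [← Fintype.card_coe]
  refine σ.dvd_card_of_forall_pow_apply_eq n fun x j hx => h x.1 x.2 j ?_
  rw [← hσ, hx]

omit [CommGroup G] [Fintype G] in
theorem coeff_sum_single_one {R : Type*} [Semiring R] (D : Finset G) (g : G) :
    (∑ d ∈ D, MonoidAlgebra.single d (1 : R)).coeff g = if g ∈ D then 1 else 0 := by
  simp [MonoidAlgebra.coeff_sum, MonoidAlgebra.coeff_single, Finsupp.single_apply]

theorem card_filter_mul_eq {D : Finset G} {v k l m : ℕ} (hD : IsPDS D v k l m)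
    (g : G) :
    ((D ×ˢ D).filter (fun x => x.1 * x.2⁻¹ = g)).card =
      if g = 1 then k else if g ∈ D then l else m := by
  obtain ⟨-, hk, hl, hm⟩ := hD
  by_cases hg : g = 1
  · rw [if_pos hg, ← hk, ← Finset.diag_card D]
    congr 1
    ext ⟨x, y⟩
    simp only [Finset.mem_filter, Finset.mem_product, Finset.mem_diag, hg, mul_inv_eq_one]
    grind
  · have : ((D ×ˢ D).filter (fun x => x.1 * x.2⁻¹ = g)).card = pdsReps D g := by
      rw [pdsReps]
      congr 1
      refine Finset.filter_congr fun x _ => ⟨fun h => ⟨fun e => hg ?_, h⟩, fun h => h.2⟩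
      rw [← h, e, mul_inv_cancel]
    rw [if_neg hg, this]
    split_ifs with h
    · exact hl g hg h
    · exact hm g hg h

theorem groupRing_mul_self {R : Type*} [CommRing R] {D : Finset G} {v k l m : ℕ}
    (hD : IsPDS D v k l m) (hreg : IsRegularPDS D) :
    (∑ d ∈ D, MonoidAlgebra.single d (1 : R)) * (∑ d ∈ D, MonoidAlgebra.single d (1 : R)) =
      ((l : R) - m) • (∑ d ∈ D, MonoidAlgebra.single d (1 : R)) +
      ((k : R) - m) • (1 : MonoidAlgebra R G) +
      (m : R) • ∑ g : G, MonoidAlgebra.single g (1 : R) := by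
  have hinv : ∑ d ∈ D, MonoidAlgebra.single d (1 : R) =
      ∑ d ∈ D, MonoidAlgebra.single d⁻¹ (1 : R) :=
    Finset.sum_nbij' (·⁻¹) (·⁻¹) hreg.1 hreg.1 (by simp) (by simp) (by simp)
  have hmul : (∑ d ∈ D, MonoidAlgebra.single d (1 : R)) *
      (∑ d ∈ D, MonoidAlgebra.single d (1 : R)) =
      ∑ x ∈ D ×ˢ D, MonoidAlgebra.single (x.1 * x.2⁻¹) (1 : R) := by
    nth_rewrite 2 [hinv]
    simp [Finset.sum_mul_sum, Finset.sum_product, MonoidAlgebra.single_mul_single]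
  rw [hmul]
  ext g
  have := congrArg (Nat.cast : ℕ → R) (card_filter_mul_eq hD g)
  rw [Finset.card_filter] at this
  push_cast at this
  simp only [MonoidAlgebra.coeff_add, MonoidAlgebra.coeff_smul, Finsupp.add_apply,
    Finsupp.smul_apply, coeff_sum_single_one]
  rw [MonoidAlgebra.coeff_sum, Finsupp.finsetSum_apply]
  simp only [MonoidAlgebra.coeff_single, Finsupp.single_apply, this, MonoidAlgebra.one_def]
  by_cases hg : g = 1
  · simp [hg, hreg.2]
  · by_cases hgD : g ∈ D <;> simp [hg, Ne.symm hg, hgD]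

omit [DecidableEq G] in
theorem groupRing_mul_univ {R : Type*} [CommRing R] (D : Finset G) :
    (∑ d ∈ D, MonoidAlgebra.single d (1 : R)) * ∑ g : G, MonoidAlgebra.single g (1 : R) =
      (D.card : R) • ∑ g : G, MonoidAlgebra.single g (1 : R) := by
  have h (d : G) : MonoidAlgebra.single d (1 : R) * ∑ g : G, MonoidAlgebra.single g (1 : R) =
      ∑ g : G, MonoidAlgebra.single g (1 : R) := by
    simp only [Finset.mul_sum, MonoidAlgebra.single_mul_single, one_mul]
    exact Fintype.sum_equiv (Equiv.mulLeft d) _ _ fun _ => rfl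
  rw [Finset.sum_mul, Finset.sum_congr rfl fun d _ => h d, Finset.sum_const, Nat.cast_smul_eq_nsmul]

open Polynomial in
theorem prod_X_sub_C_dvd_X_pow_prime_sub_X {q : ℕ} [Fact q.Prime] {a b c : ZMod q}
    (hab : a ≠ b) (hac : a ≠ c) (hbc : b ≠ c) :
    (X - C a) * (X - C b) * (X - C c) ∣ (X ^ q - X : (ZMod q)[X]) := by
  have hdvd (e : ZMod q) : X - C e ∣ (X ^ q - X : (ZMod q)[X]) := by
    simp [dvd_iff_isRoot]
  refine IsCoprime.mul_dvd (IsCoprime.mul_left ?_ ?_)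
    (IsCoprime.mul_dvd ?_ (hdvd a) (hdvd b)) (hdvd c) <;>
    exact isCoprime_X_sub_C_of_isUnit_sub (sub_ne_zero.2 ‹_›).isUnit

theorem groupRing_pow_prime_eq {D : Finset G} {v k l m q : ℕ} [Fact q.Prime]
    (hD : IsPDS D v k l m) (hreg : IsRegularPDS D) {a b : ZMod q}
    (hsum : a + b = l - m) (hprod : a * b = m - k) (hab : a ≠ b) (hak : a ≠ k) (hbk : b ≠ k) :
    (∑ d ∈ D, MonoidAlgebra.single d (1 : ZMod q)) ^ q =
      ∑ d ∈ D, MonoidAlgebra.single d (1 : ZMod q) := by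
  have hX := groupRing_mul_self (R := ZMod q) hD hreg
  have hJ := groupRing_mul_univ (R := ZMod q) D
  rw [hD.2.1] at hJ
  set X := ∑ d ∈ D, MonoidAlgebra.single d (1 : ZMod q)
  set J := ∑ g : G, MonoidAlgebra.single g (1 : ZMod q)
  obtain ⟨Q, hQ⟩ := prod_X_sub_C_dvd_X_pow_prime_sub_X hab hak hbk
  have hev := congrArg (Polynomial.aeval X) hQ
  simp only [map_mul, map_sub, map_pow, Polynomial.aeval_X, Polynomial.aeval_C] at hev
  have hfac : (X - algebraMap _ _ a) * (X - algebraMap _ _ b) = (m : ZMod q) • J := by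
    have e1 := congrArg (algebraMap (ZMod q) (MonoidAlgebra (ZMod q) G)) hsum
    have e2 := congrArg (algebraMap (ZMod q) (MonoidAlgebra (ZMod q) G)) hprod
    simp only [Algebra.smul_def, map_add, map_sub, map_mul] at e1 e2 hX ⊢
    linear_combination hX - X * e1 + e2
  have hzero : (m : ZMod q) • J * (X - algebraMap _ _ (k : ZMod q)) = 0 := by
    simp only [Algebra.smul_def] at hJ ⊢
    linear_combination algebraMap (ZMod q) (MonoidAlgebra (ZMod q) G) m * hJ
  rw [hfac, hzero, zero_mul] at hev
  exact sub_eq_zero.1 hev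

theorem IsPDS.pow_prime_mem {D : Finset G} {v k l m q : ℕ} [Fact q.Prime]
    (hD : IsPDS D v k l m) (hreg : IsRegularPDS D) {a b : ZMod q}
    (hsum : a + b = l - m) (hprod : a * b = m - k) (hab : a ≠ b) (hak : a ≠ k) (hbk : b ≠ k)
    (hq : (Nat.card G).Coprime q) {d : G} (hd : d ∈ D) : d ^ q ∈ D := by
  have h := groupRing_pow_prime_eq hD hreg hsum hprod hab hak hbk
  have : CharP (MonoidAlgebra (ZMod q) G) q :=
    charP_of_injective_algebraMap (FaithfulSMul.algebraMap_injective (ZMod q) _) q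
  rw [sum_pow_char] at h
  simp only [MonoidAlgebra.single_pow, one_pow] at h
  have hc := congrArg (fun x => x.coeff (d ^ q)) h
  simp only [coeff_sum_single_one] at hc
  rw [MonoidAlgebra.coeff_sum, Finsupp.finsetSum_apply] at hc
  have hinj (x : G) : x ^ q = d ^ q ↔ x = d := (powCoprime hq).injective.eq_iff
  simp only [MonoidAlgebra.coeff_single, Finsupp.single_apply, hinj] at hc
  by_contra hcon
  simp [hd, hcon] at hc

omit [DecidableEq G] [Fintype G] in
/-- Counting pairs with quotient in `A` by their common coset. -/
theorem card_filter_mul_inv_mem_eq_sum (D : Finset G) (A : Subgroup G) [DecidablePred (· ∈ A)]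
    [DecidableEq (G ⧸ A)] [Fintype (G ⧸ A)] :
    ((D ×ˢ D).filter (fun x => x.1 * x.2⁻¹ ∈ A)).card =
      ∑ c : G ⧸ A, (D.filter (fun x : G => (x : G ⧸ A) = c)).card ^ 2 := by
  rw [Finset.card_eq_sum_card_fiberwise (f := fun x : G × G => (x.1 : G ⧸ A)) (t := Finset.univ)
    fun _ _ => by simp]
  refine Finset.sum_congr rfl fun c _ => ?_
  rw [sq, ← Finset.card_product]
  congr 1
  ext ⟨x, y⟩
  have : x * y⁻¹ ∈ A ↔ (x : G ⧸ A) = y := by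
    rw [eq_comm, QuotientGroup.eq, mul_comm]
  simp only [Finset.mem_filter, Finset.mem_product, this]
  grind

omit [DecidableEq G] in
/-- If `D = D⁻¹` then in the odd-order quotient `G ⧸ A` the nontrivial cosets pair off. -/
theorem four_dvd_card_sub (D : Finset G) (hinv : ∀ d ∈ D, d⁻¹ ∈ D) (A : Subgroup G)
    [DecidablePred (· ∈ A)] (hA : Odd A.index) :
    (4 : ℤ) ∣ ((D ×ˢ D).filter (fun x => x.1 * x.2⁻¹ ∈ A)).card - D.card -
      ((D.filter (· ∈ A)).card : ℤ) * ((D.filter (· ∈ A)).card - 1) := by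
  classical
  let d (c : G ⧸ A) : ℤ := (D.filter (fun x : G => (x : G ⧸ A) = c)).card
  have hd1 : d 1 = (D.filter (· ∈ A)).card := by
    simp only [d, QuotientGroup.eq_one_iff]
  have hdinv (c : G ⧸ A) : d c⁻¹ = d c := by
    simp only [d, Nat.cast_inj]
    refine Finset.card_nbij' (·⁻¹) (·⁻¹) ?_ ?_ (fun x _ => inv_inv x) (fun x _ => inv_inv x)
    · intro x hx
      simp only [Finset.mem_coe, Finset.mem_filter] at hx ⊢
      exact ⟨hinv _ hx.1, by rw [QuotientGroup.mk_inv, hx.2, inv_inv]⟩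
    · intro x hx
      simp only [Finset.mem_coe, Finset.mem_filter] at hx ⊢
      exact ⟨hinv _ hx.1, by rw [QuotientGroup.mk_inv, hx.2]⟩
  have hcard : (D.card : ℤ) = ∑ c : G ⧸ A, d c := by
    rw [Finset.card_eq_sum_card_fiberwise (f := fun x : G => (x : G ⧸ A)) (t := Finset.univ)
      fun _ _ => by simp]
    push_cast
    rfl
  have hcard2 : (((D ×ˢ D).filter (fun x => x.1 * x.2⁻¹ ∈ A)).card : ℤ) =
      ∑ c : G ⧸ A, d c ^ 2 := by
    rw [card_filter_mul_inv_mem_eq_sum]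
    push_cast
    rfl
  have hsum : ∑ c ∈ Finset.univ.erase (1 : G ⧸ A), ((d c * (d c - 1) : ℤ) : ZMod 4) = 0 := by
    refine Finset.sum_involution (fun c _ => c⁻¹) ?_ ?_ ?_ ?_
    · intro c _
      rw [hdinv, ← Int.cast_add, ZMod.intCast_zmod_eq_zero_iff_dvd _ 4]
      obtain ⟨e, he⟩ := Int.even_mul_pred_self (d c)
      exact ⟨e, by rw [he]; push_cast; ring⟩
    · intro c hc _ heq
      refine (Finset.mem_erase.1 hc).1 ?_
      have h2 : c ^ 2 = 1 := by rw [sq]; nth_rewrite 1 [← heq]; simp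
      have hco : (Nat.card (G ⧸ A)).Coprime 2 := hA.coprime_two_right
      exact (powCoprime hco).injective (by simpa using h2)
    · simp
    · simp
  rw [← Int.cast_sum, ZMod.intCast_zmod_eq_zero_iff_dvd _ 4] at hsum
  have hsplit : ∑ c ∈ Finset.univ.erase (1 : G ⧸ A), d c * (d c - 1) =
      ∑ c : G ⧸ A, d c ^ 2 - ∑ c : G ⧸ A, d c - d 1 * (d 1 - 1) := by
    rw [← Finset.sum_sub_distrib, ← Finset.add_sum_erase _ _ (Finset.mem_univ (1 : G ⧸ A)),
      Finset.sum_congr rfl fun c _ => (by ring : d c * (d c - 1) = d c ^ 2 - d c)]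
    ring
  rw [hcard, hcard2, ← hd1, ← hsplit]
  exact hsum

/-- The number of pairs with quotient in a subgroup `A`, for a regular PDS. -/
theorem IsPDS.card_filter_mul_inv_mem {D : Finset G} {v k l m : ℕ} (hD : IsPDS D v k l m)
    (hreg : IsRegularPDS D) (A : Subgroup G) [DecidablePred (· ∈ A)] :
    (((D ×ˢ D).filter (fun x => x.1 * x.2⁻¹ ∈ A)).card : ℤ) =
      k + (D.filter (· ∈ A)).card * l +
        (Nat.card A - 1 - (D.filter (· ∈ A)).card) * m := by
  have hA : Nat.card A = (Finset.univ.filter (· ∈ A)).card := by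
    rw [Nat.card_eq_fintype_card, Fintype.card_subtype]
  have h1 : (1 : G) ∈ Finset.univ.filter (· ∈ A) := by simp [A.one_mem]
  have hint : D.filter (· ∈ A) = ((Finset.univ.filter (· ∈ A)).erase 1).filter (· ∈ D) := by
    ext x
    have := hreg.2
    simp only [Finset.mem_filter, Finset.mem_erase, Finset.mem_univ, true_and]
    grind
  rw [Finset.card_eq_sum_card_fiberwise (f := fun x => x.1 * x.2⁻¹)
    (t := Finset.univ.filter (· ∈ A)) fun x hx => by simpa using (Finset.mem_filter.1 hx).2]
  have hfib : ∀ g ∈ Finset.univ.filter (· ∈ A),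
      (((D ×ˢ D).filter (fun x => x.1 * x.2⁻¹ ∈ A)).filter
        (fun x => x.1 * x.2⁻¹ = g)).card = if g = 1 then k else if g ∈ D then l else m := by
    intro g hg
    rw [← card_filter_mul_eq hD g, Finset.filter_filter]
    congr 1
    refine Finset.filter_congr fun x _ => ⟨fun h => h.2, fun h => ⟨?_, h⟩⟩
    rw [h]
    simpa using hg
  rw [Finset.sum_congr rfl hfib, ← Finset.add_sum_erase _ _ h1, if_pos rfl,
    Finset.sum_congr rfl fun g hg => if_neg (Finset.ne_of_mem_erase hg), Finset.sum_ite, hint]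
  have hcount := Finset.card_filter_add_card_filter_not (s := (Finset.univ.filter (· ∈ A)).erase 1)
    (p := (· ∈ D))
  rw [Finset.card_erase_of_mem h1, ← hA] at hcount
  have hpos : 0 < Nat.card A := Nat.card_pos
  simp only [Finset.sum_const, smul_eq_mul]
  zify [hpos] at hcount
  push_cast
  rw [← hcount]
  ring

omit [DecidableEq G] [Fintype G] in
theorem Subgroup.mem_of_pow_mem_of_coprime_index (A : Subgroup G) {n : ℕ}
    (hn : A.index.Coprime n) {x : G} (hx : x ^ n ∈ A) : x ∈ A := by
  rw [← QuotientGroup.eq_one_iff] at hx ⊢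
  have hco : (Nat.card (G ⧸ A)).Coprime n := hn
  exact (powCoprime hco).injective (by simpa using hx)

theorem ZMod.intCast_ne_intCast_of_lt {q : ℕ} {a b : ℤ} (h : a < b) (hq : b - a < q) :
    (a : ZMod q) ≠ b := by
  rw [Ne, ZMod.intCast_eq_intCast_iff_dvd_sub]
  intro hdvd
  have := Int.le_of_dvd (by lia) hdvd
  lia

omit [DecidableEq G] [Fintype G] in
theorem sub_one_dvd_of_primitive_root {p q r j : ℕ} [Fact p.Prime] {g : (ZMod p)ˣ}
    (hg : ∀ u, u ∈ Subgroup.zpowers g) (hq : (q : ZMod p) = g) (hq0 : 0 < q) (A : Subgroup G)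
    (hA : A.index = p ^ r) {x : G} (hxA : x ∉ A)
    (hx : x ^ q ^ j = x) : p - 1 ∣ j := by
  have hpp : p.Prime := Fact.out
  have hpow : x ^ (q ^ j - 1) = 1 := by
    have : x ^ (q ^ j - 1) * x = x := by
      rw [← pow_succ, Nat.sub_add_cancel (Nat.pow_pos hq0), hx]
    simpa using this
  have hdvd : p ∣ q ^ j - 1 := by
    by_contra hnd
    refine hxA (A.mem_of_pow_mem_of_coprime_index ?_ (hpow ▸ A.one_mem))
    rw [hA]
    exact Nat.Coprime.pow_left _ ((Nat.Prime.coprime_iff_not_dvd hpp).2 hnd)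
  have hone : g ^ j = 1 := by
    rw [← ZMod.natCast_eq_zero_iff, Nat.cast_sub (Nat.pow_pos hq0), sub_eq_zero] at hdvd
    ext
    simpa [hq] using hdvd
  rw [← orderOf_dvd_iff_pow_eq_one, orderOf_eq_card_of_forall_mem_zpowers hg,
    Nat.card_eq_fintype_card, ZMod.card_units] at hone
  exact hone

/-- For `p = 4y^2+5y+2 ≥ 5` prime, there is no nontrivial regular
`(8p^3, 4p^2-2p-4y-3, 2p-8y-8, 2p-2)`-PDS in an Abelian group. -/
theorem no_pds_case4i (y p : ℕ) (hpy : p = 4 * y ^ 2 + 5 * y + 2)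
    (hp : p.Prime) (hp5 : 5 ≤ p)
    {G : Type*} [CommGroup G] [DecidableEq G] [Fintype G]
    (D : Finset G) :
    ¬ (IsPDS D (8 * p ^ 3) (4 * p ^ 2 - 2 * p - 4 * y - 3) (2 * p - 8 * y - 8)
          (2 * p - 2) ∧
        IsRegularPDS D ∧ ¬ IsTrivialPDS D) := by
  rintro ⟨hD, hreg, -⟩
  classical
  have hfact : Fact p.Prime := ⟨hp⟩
  have hy : 1 ≤ y := by
    by_contra! h
    interval_cases y
    lia
  have hpodd : Odd p := hp.odd_of_ne_two (by lia)
  have hk : ((4 * p ^ 2 - 2 * p - 4 * y - 3 : ℕ) : ℤ) = 4 * p ^ 2 - 2 * p - 4 * y - 3 := by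
    have : 2 * p + 4 * y + 3 ≤ 4 * p ^ 2 := by nlinarith
    rw [Nat.sub_sub, Nat.sub_sub, Nat.cast_sub (by lia)]
    push_cast
    ring
  have hl : ((2 * p - 8 * y - 8 : ℕ) : ℤ) = 2 * p - 8 * y - 8 := by
    have : 8 * y + 8 ≤ 2 * p := by nlinarith
    lia
  have hm : ((2 * p - 2 : ℕ) : ℤ) = 2 * p - 2 := by lia
  have hcard : Nat.card G = 8 * p ^ 3 := by rw [Nat.card_eq_fintype_card, hD.1]
  generalize 4 * p ^ 2 - 2 * p - 4 * y - 3 = k at hD hk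
  generalize 2 * p - 8 * y - 8 = l at hD hl
  generalize 2 * p - 2 = m at hD hm
  obtain ⟨A, hA⟩ := Sylow.exists_subgroup_card_pow_prime (G := G) 2 (n := 3)
    ⟨p ^ 3, by rw [hcard]; norm_num⟩
  replace hA : Nat.card A = 8 := hA
  have hindex : A.index = p ^ 3 := by
    have := A.card_mul_index
    rw [hA, hcard] at this
    lia
  obtain ⟨g, hg⟩ := IsCyclic.exists_generator (α := (ZMod p)ˣ)
  obtain ⟨q, hqgt, hqp, hqg⟩ := Nat.forall_exists_prime_gt_and_eq_mod g.isUnit (8 * p ^ 3)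
  have hqfact : Fact q.Prime := ⟨hqp⟩
  have hcopq : (Nat.card G).Coprime q := by
    rw [hcard, Nat.coprime_comm]
    exact (hqp.coprime_iff_not_dvd).2 fun h => by
      have := Nat.le_of_dvd (by positivity) h
      lia
  have hqgt' : 8 * (p : ℤ) ^ 3 < q := by exact_mod_cast hqgt
  have hp5' : (5 : ℤ) ≤ p := by exact_mod_cast hp5
  have hpow : ∀ d ∈ D, d ^ q ∈ D := by
    intro d hd
    refine hD.pow_prime_mem hreg (a := ((-4 * y - 3 - 2 * p : ℤ) : ZMod q))
      (b := ((-4 * y - 3 + 2 * p : ℤ) : ZMod q)) ?_ ?_ ?_ ?_ ?_ hcopq hd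
    · have : (-4 * y - 3 - 2 * p : ℤ) + (-4 * y - 3 + 2 * p) = l - m := by lia
      exact_mod_cast congrArg (Int.cast : ℤ → ZMod q) this
    · have : (-4 * y - 3 - 2 * p : ℤ) * (-4 * y - 3 + 2 * p) = m - k := by
        rw [hm, hk, hpy]
        push_cast
        ring
      exact_mod_cast congrArg (Int.cast : ℤ → ZMod q) this
    · exact ZMod.intCast_ne_intCast_of_lt (by lia) (by nlinarith)
    · rw [← Int.cast_natCast k]
      exact ZMod.intCast_ne_intCast_of_lt (by rw [hk]; nlinarith) (by rw [hk]; nlinarith)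
    · rw [← Int.cast_natCast k]
      exact ZMod.intCast_ne_intCast_of_lt (by rw [hk]; nlinarith) (by rw [hk]; nlinarith)
  have hdvd : p - 1 ∣ (D.filter (· ∉ A)).card := by
    refine dvd_card_of_forall_pow_pow_eq _ q _ hcopq (fun x hx => ?_) fun x hx j hj => ?_
    · rw [Finset.mem_filter] at hx ⊢
      exact ⟨hpow x hx.1, fun h => hx.2 (A.mem_of_pow_mem_of_coprime_index
        (hcopq.coprime_dvd_left A.index_dvd_card) h)⟩
    · exact sub_one_dvd_of_primitive_root hg hqg hqp.pos A hindex (Finset.mem_filter.1 hx).2 hj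
  have hsplit := Finset.card_filter_add_card_filter_not (s := D) (p := (· ∈ A))
  have hn : (D.filter (· ∈ A)).card ≤ 7 := by
    have hsub : D.filter (· ∈ A) ⊆ (Finset.univ.filter (· ∈ A)).erase 1 := by
      intro x hx
      have := hreg.2
      simp only [Finset.mem_filter, Finset.mem_erase, Finset.mem_univ, true_and] at hx ⊢
      grind
    refine (Finset.card_le_card hsub).trans ?_
    rw [Finset.card_erase_of_mem (by simp [A.one_mem]), ← Fintype.card_subtype,
      ← Nat.card_eq_fintype_card]
    exact (congrArg (· - 1) hA).le
  have hfour := four_dvd_card_sub D hreg.1 A (by rw [hindex]; exact hpodd.pow)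
  rw [hD.card_filter_mul_inv_mem hreg A, hA, hD.2.1] at hfour
  rw [hD.2.1] at hsplit
  generalize (D.filter (· ∈ A)).card = n at hsplit hn hfour
  obtain ⟨c, hc⟩ := hdvd
  have hkey : (n : ℤ) + 4 * y + 1 = (4 * y ^ 2 + 5 * y + 1) * (4 * p + 2 - c) := by
    have h1 : ((p - 1 : ℕ) : ℤ) = p - 1 := by lia
    rw [hc] at hsplit
    zify [h1] at hsplit
    have hpy' : (p : ℤ) = 4 * y ^ 2 + 5 * y + 2 := by exact_mod_cast hpy
    have h2 : (4 * y ^ 2 + 5 * y + 1 : ℤ) = p - 1 := by lia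
    rw [h2]
    linear_combination hsplit + hk
  generalize (4 * p + 2 - c : ℤ) = e at hkey
  have he : 1 ≤ e := by
    by_contra! h
    nlinarith
  have hy1 : y = 1 := by
    by_contra h
    have : (2 : ℤ) ≤ y := by lia
    nlinarith
  subst hy1
  norm_num at hpy hkey
  subst hpy
  have hn5 : n = 5 := by lia
  subst hn5
  rw [hl, hm] at hfour
  norm_num at hfour
  lia
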